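/- (Theorem 1.5, hyperbolic orbit with prescribed asymptotic direction) Suppose V satisfies (B₁), (V₁) and (V₂). Then for every H > 0 and every unit vector e ∈ ℝ^N there exists a twice continuously differentiable curve u : ℝ → ℝ^N \ {0} such that ü(t) + ∇V(u(t)) = 0 and ½|u̇(t)|² + V(u(t)) = H for all t ∈ ℝ, |u(t)| → +∞ as t → ±∞, and u(t)/|u(t)| → e as t → +∞ and as t → -∞. -/

import Mathlib

open scoped InnerProductSpace

theorem ContinuousLinearMap.exists_det_one_add_eq_sum {E : Type*} [NormedAddCommGroup E]
    [NormedSpace ℝ E] [FiniteDimensional ℝ E] {ε : ℝ} (hε : 0 < ε) :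
    ∃ (n : ℕ) (t c : ℕ → ℝ), (∀ i, 0 < t i ∧ t i ≤ ε) ∧ ∑ i ∈ Finset.range n, c i = 1 ∧
      ∀ A : E →L[ℝ] E, (1 + A).det = ∑ i ∈ Finset.range n, c i * (1 + t i • A).det := by
  classical
  set d := Module.finrank ℝ E
  let t : ℕ → ℝ := fun i => ε / (i + 1)
  have htinj : Set.InjOn t (Finset.range (d + 1)) := by
    intro i _ j _ hij
    have hi : (0 : ℝ) < i + 1 := by positivity
    have hj : (0 : ℝ) < j + 1 := by positivity
    have : ε / ((i : ℝ) + 1) = ε / (j + 1) := hij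
    rw [div_eq_div_iff hi.ne' hj.ne'] at this
    have := mul_left_cancel₀ hε.ne' this
    exact_mod_cast (add_right_cancel this).symm
  have hne : (Finset.range (d + 1)).Nonempty := ⟨0, by simp⟩
  refine ⟨d + 1, t, fun i => (Lagrange.basis (Finset.range (d + 1)) t i).eval 1, ?_, ?_, ?_⟩
  · intro i
    refine ⟨by positivity, div_le_self hε.le (by simp)⟩
  · rw [← Polynomial.eval_finsetSum, Lagrange.sum_basis htinj hne, Polynomial.eval_one]
  · intro A
    let b := Module.finBasis ℝ E
    let M := LinearMap.toMatrix b b (A : E →ₗ[ℝ] E)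
    let p : Polynomial ℝ := Matrix.det ((Polynomial.X : Polynomial ℝ) • M.map Polynomial.C +
      (1 : Matrix (Fin d) (Fin d) ℝ).map Polynomial.C)
    have hp : ∀ s : ℝ, p.eval s = (1 + s • A).det := by
      intro s
      have h1 : (1 + s • A).det = LinearMap.det (((1 + s • A : E →L[ℝ] E)) : E →ₗ[ℝ] E) := rfl
      have h2 : ((1 + s • A : E →L[ℝ] E) : E →ₗ[ℝ] E) = LinearMap.id + s • (A : E →ₗ[ℝ] E) := by
        ext x; simp
      rw [h1, ← LinearMap.det_toMatrix b, ← Polynomial.coe_evalRingHom, RingHom.map_det, h2,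
        map_add (LinearMap.toMatrix b b), map_smul (LinearMap.toMatrix b b), LinearMap.toMatrix_id]
      congr 1
      ext i j
      by_cases hij : i = j <;> simp [M, hij, add_comm, mul_comm s]
    have hdeg : p.degree < (Finset.range (d + 1)).card := by
      rw [Finset.card_range]
      refine Polynomial.degree_le_natDegree.trans_lt ?_
      have := Polynomial.natDegree_det_X_add_C_le M 1
      rw [Fintype.card_fin] at this
      exact_mod_cast Nat.lt_succ_of_le this
    have h3 := congrArg (Polynomial.eval 1) (Lagrange.eq_interpolate htinj hdeg)
    rw [hp, one_smul, Lagrange.interpolate_apply, Polynomial.eval_finsetSum] at h3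
    rw [h3]
    refine Finset.sum_congr rfl fun i _ => ?_
    rw [Polynomial.eval_mul, Polynomial.eval_C, hp, mul_comm]

theorem ContinuousLinearMap.det_one_add_pos {E : Type*} [NormedAddCommGroup E]
    [NormedSpace ℝ E] [FiniteDimensional ℝ E] {A : E →L[ℝ] E} (hA : ‖A‖ < 1) :
    0 < (1 + A).det := by
  have hne : ∀ s ∈ Set.Icc (0 : ℝ) 1, (1 + s • A).det ≠ 0 := by
    intro s hs h0
    have h0' : LinearMap.det ((1 + s • A : E →L[ℝ] E) : E →ₗ[ℝ] E) = 0 := h0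
    obtain ⟨x, hx, hx0⟩ := (Submodule.ne_bot_iff _).1
      (LinearMap.bot_lt_ker_of_det_eq_zero h0').ne'
    have hx1 : x = -(s • A x) := by
      have : x + s • A x = 0 := by simpa using hx
      exact eq_neg_of_add_eq_zero_left this
    have h1 : ‖x‖ ≤ ‖A‖ * ‖x‖ := by
      calc ‖x‖ = s * ‖A x‖ := by
            conv_lhs => rw [hx1]
            rw [norm_neg, norm_smul, Real.norm_of_nonneg hs.1]
        _ ≤ 1 * ‖A x‖ := by gcongr; exact hs.2
        _ ≤ ‖A‖ * ‖x‖ := by rw [one_mul]; exact A.le_opNorm x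
    nlinarith [norm_pos_iff.2 hx0]
  have hcont : Continuous fun s : ℝ => (1 + s • A).det :=
    ContinuousLinearMap.continuous_det.comp (by fun_prop)
  by_contra hneg
  push Not at hneg
  obtain ⟨s, hs, hs0⟩ := intermediate_value_Icc' zero_le_one hcont.continuousOn
    (show (0 : ℝ) ∈ Set.Icc _ _ from ⟨by simpa using hneg, by
      simp only [zero_smul, add_zero]
      rw [show (1 : E →L[ℝ] E).det = 1 from LinearMap.det_id]
      exact zero_le_one⟩)
  exact hne s hs hs0

open MeasureTheory Metric in
theorem LipschitzWith.integral_det_one_add_fderiv {E : Type*} [NormedAddCommGroup E]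
    [NormedSpace ℝ E] [FiniteDimensional ℝ E] [MeasurableSpace E] [BorelSpace E]
    (μ : Measure E) [μ.IsAddHaarMeasure] {g : E → E} {g' : E → E →L[ℝ] E} {K : NNReal}
    (hg : LipschitzWith K g) (hg0 : ∀ x, 1 ≤ ‖x‖ → g x = 0)
    (hg' : ∀ x ∈ ball (0 : E) 1, HasFDerivAt g (g' x) x) :
    ∫ x in ball (0 : E) 1, (1 + g' x).det ∂μ = μ.real (ball 0 1) := by
  obtain ⟨n, t, c, ht, hc, hdet⟩ :=
    ContinuousLinearMap.exists_det_one_add_eq_sum (E := E) (ε := 1 / (K + 1)) (by positivity)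
  have htK : ∀ i, t i * K < 1 := fun i => by
    have hK : (0 : ℝ) ≤ K := K.2
    calc t i * K ≤ 1 / (K + 1) * K := by gcongr; exact (ht i).2
      _ < 1 := by rw [one_div, inv_mul_lt_iff₀ (by positivity)]; linarith
  have key : ∀ i, IntegrableOn (fun x => (1 + t i • g' x).det) (ball (0 : E) 1) μ ∧
      ∫ x in ball (0 : E) 1, (1 + t i • g' x).det ∂μ = μ.real (ball 0 1) := by
    intro i
    set f : E → E := fun x => x + t i • g x
    have hlip : LipschitzWith (Real.toNNReal (t i) * K) (fun x => t i • g x) := by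
      refine LipschitzWith.of_dist_le_mul fun x y => ?_
      rw [dist_smul₀, Real.norm_of_nonneg (ht i).1.le, NNReal.coe_mul,
        Real.coe_toNNReal _ (ht i).1.le, mul_assoc]
      exact mul_le_mul_of_nonneg_left (hg.dist_le_mul x y) (ht i).1.le
    have hlt : Real.toNNReal (t i) * K < 1 := by
      rw [← NNReal.coe_lt_coe, NNReal.coe_mul, Real.coe_toNNReal _ (ht i).1.le]
      exact htK i
    have hinj : Function.Injective f := by
      intro x y hxy
      by_contra hne
      have h1 : x - y = t i • g y - t i • g x := by
        have : x + t i • g x = y + t i • g y := hxy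
        rw [sub_eq_sub_iff_add_eq_add, this, add_comm]
      have h2 := hlip.dist_le_mul y x
      rw [dist_eq_norm, ← h1, dist_comm, dist_eq_norm] at h2
      have h3 : ((Real.toNNReal (t i) * K : NNReal) : ℝ) < 1 := by exact_mod_cast hlt
      nlinarith [norm_pos_iff.2 (sub_ne_zero.2 hne)]
    have hsurj : Function.Surjective f := by
      intro y
      have hcon : ContractingWith (Real.toNNReal (t i) * K) (fun x => y - t i • g x) := by
        refine ⟨hlt, LipschitzWith.of_dist_le_mul fun a b => ?_⟩
        rw [dist_sub_left]
        exact hlip.dist_le_mul a b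
      refine ⟨ContractingWith.fixedPoint _ hcon, ?_⟩
      have := hcon.fixedPoint_isFixedPt
      have h2 : y - t i • g (ContractingWith.fixedPoint _ hcon) =
        ContractingWith.fixedPoint _ hcon := this
      exact (sub_eq_iff_eq_add.1 h2).symm
    have hout : ∀ x, 1 ≤ ‖x‖ → f x = x := fun x hx => by simp [f, hg0 x hx]
    have himg : f '' ball 0 1 = ball 0 1 := by
      ext y
      simp only [Set.mem_image, mem_ball_zero_iff]
      constructor
      · rintro ⟨x, hx, rfl⟩
        by_contra hge
        push Not at hge
        have := hinj (hout _ hge)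
        rw [this] at hge
        linarith
      · intro hy
        obtain ⟨x, rfl⟩ := hsurj y
        refine ⟨x, ?_, rfl⟩
        by_contra hge
        push Not at hge
        rw [hout x hge] at hy
        linarith
    have hder : ∀ x ∈ ball (0 : E) 1,
        HasFDerivWithinAt f (1 + t i • g' x) (ball 0 1) x := fun x hx =>
      ((hasFDerivAt_id x).add ((hg' x hx).const_smul (t i))).hasFDerivWithinAt
    have habs : ∀ x ∈ ball (0 : E) 1,
        |(1 + t i • g' x).det| • (1 : ℝ) = (1 + t i • g' x).det := by
      intro x hx
      rw [smul_eq_mul, mul_one, abs_of_pos]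
      refine ContinuousLinearMap.det_one_add_pos ?_
      rw [norm_smul, Real.norm_of_nonneg (ht i).1.le]
      exact (mul_le_mul_of_nonneg_left ((hg' x hx).le_of_lipschitz hg) (ht i).1.le).trans_lt
        (htK i)
    constructor
    · have := (integrableOn_image_iff_integrableOn_abs_det_fderiv_smul μ measurableSet_ball hder
        hinj.injOn (fun _ => (1 : ℝ))).1
          (by rw [himg]; exact integrableOn_const measure_ball_lt_top.ne)
      exact this.congr_fun habs measurableSet_ball
    · have := integral_image_eq_integral_abs_det_fderiv_smul μ measurableSet_ball hder
        hinj.injOn (fun _ => (1 : ℝ))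
      rw [himg, setIntegral_congr_fun measurableSet_ball habs] at this
      rw [← this, setIntegral_const, smul_eq_mul, mul_one]
  rw [integral_congr_ae (Filter.Eventually.of_forall fun x => hdet (g' x)),
    integral_finsetSum _ fun i _ => ((key i).1.const_mul (c i))]
  simp_rw [integral_const_mul, (key _).2]
  rw [← Finset.sum_mul, hc, one_mul]

open Metric in
theorem lipschitzWith_of_eq_zero_off_ball {E F : Type*} [NormedAddCommGroup E] [NormedSpace ℝ E]
    [NormedAddCommGroup F] {g : E → F} {K : NNReal} (hg : LipschitzOnWith K g (closedBall 0 1))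
    (hg0 : ∀ x, 1 ≤ ‖x‖ → g x = 0) : LipschitzWith K g := by
  have aux : ∀ x y : E, ‖x‖ ≤ 1 → 1 ≤ ‖y‖ → dist (g x) (g y) ≤ K * dist x y := by
    intro x y hx hy
    obtain ⟨s, hs, hs1⟩ := intermediate_value_Icc zero_le_one
      (f := fun s : ℝ => ‖AffineMap.lineMap x y s‖)
      (by have : Continuous (AffineMap.lineMap (k := ℝ) x y) := AffineMap.lineMap_continuous
          exact this.norm.continuousOn)
      (show (1 : ℝ) ∈ Set.Icc _ _ by simpa using ⟨hx, hy⟩)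
    simp only at hs1
    set z := AffineMap.lineMap x y s
    rw [hg0 y hy, ← hg0 z hs1.ge]
    refine (hg.dist_le_mul x (by simpa using hx) z (by simpa using hs1.le)).trans ?_
    gcongr
    rw [dist_left_lineMap, Real.norm_of_nonneg hs.1]
    exact mul_le_of_le_one_left dist_nonneg hs.2
  refine LipschitzWith.of_dist_le_mul fun x y => ?_
  rcases le_total ‖x‖ 1 with hx | hx <;> rcases le_total ‖y‖ 1 with hy | hy
  · exact hg.dist_le_mul x (by simpa using hx) y (by simpa using hy)
  · exact aux x y hx hy
  · rw [dist_comm, dist_comm x]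
    exact aux y x hy hx
  · rw [hg0 x hx, hg0 y hy, dist_self]
    positivity

open MeasureTheory Metric in
theorem not_contDiff_retraction_sphere {E : Type*} [NormedAddCommGroup E]
    [InnerProductSpace ℝ E] [FiniteDimensional ℝ E] {r : E → E} (hr : ContDiff ℝ 1 r)
    (hr1 : ∀ x, ‖r x‖ = 1) (hr2 : ∀ x, ‖x‖ = 1 → r x = x) : False := by
  let _ : MeasurableSpace E := borel E
  have _ : BorelSpace E := ⟨rfl⟩
  obtain ⟨K, hK⟩ : ∃ K, LipschitzOnWith K (fun x => r x - x) (closedBall 0 1) :=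
    (hr.sub contDiff_id).contDiffOn.exists_lipschitzOnWith one_ne_zero (convex_closedBall _ _)
      (isCompact_closedBall _ _)
  set g : E → E := fun x => if ‖x‖ ≤ 1 then r x - x else 0 with hgdef
  have hgeq : ∀ x, ‖x‖ ≤ 1 → g x = r x - x := fun x hx => if_pos hx
  have hg0 : ∀ x, 1 ≤ ‖x‖ → g x = 0 := by
    intro x hx
    rcases hx.eq_or_lt with h | h
    · rw [hgeq x h.ge, hr2 x h.symm, sub_self]
    · exact if_neg (not_le.2 h)
  have hgl : LipschitzWith K g := by
    refine lipschitzWith_of_eq_zero_off_ball (fun x hx y hy => ?_) hg0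
    rw [hgeq x (by simpa using hx), hgeq y (by simpa using hy)]
    exact hK hx hy
  have hrd : ∀ x, HasFDerivAt r (fderiv ℝ r x) x := fun x =>
    (hr.differentiable one_ne_zero x).hasFDerivAt
  have hg' : ∀ x ∈ ball (0 : E) 1, HasFDerivAt g (fderiv ℝ r x - 1) x := by
    intro x hx
    refine ((hrd x).sub (hasFDerivAt_id x)).congr_of_eventuallyEq ?_
    filter_upwards [isOpen_ball.mem_nhds hx] with y hy
    exact hgeq y (mem_ball_zero_iff.1 hy).le
  have hint := hgl.integral_det_one_add_fderiv (volume : Measure E) hg0 hg'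
  have hdet : ∀ x, (1 + (fderiv ℝ r x - 1)).det = 0 := by
    intro x
    rw [add_sub_cancel]
    by_contra hne
    have h1 : HasFDerivAt (fun y => ⟪r y, r y⟫_ℝ) _ x := (hrd x).inner ℝ (hrd x)
    have h2 : HasFDerivAt (fun y => ⟪r y, r y⟫_ℝ) (0 : E →L[ℝ] ℝ) x := by
      have : (fun y => ⟪r y, r y⟫_ℝ) = fun _ => (1 : ℝ) := by
        ext y; rw [real_inner_self_eq_norm_sq, hr1, one_pow]
      rw [this]
      exact hasFDerivAt_const _ _
    have h3 := h1.unique h2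
    have hu : IsUnit (LinearMap.det (fderiv ℝ r x : E →ₗ[ℝ] E)) := isUnit_iff_ne_zero.2 hne
    obtain ⟨v, hv⟩ := (LinearEquiv.ofIsUnitDet (v := Module.finBasis ℝ E)
      (v' := Module.finBasis ℝ E) (f := (fderiv ℝ r x : E →ₗ[ℝ] E)) (by
        rwa [LinearMap.det_toMatrix])).surjective (r x)
    have hv' : fderiv ℝ r x v = r x := hv
    have h4 := congrArg (fun L : E →L[ℝ] ℝ => L v) h3
    simp [hv', hr1] at h4
  simp_rw [hdet, integral_zero] at hint
  exact (ENNReal.toReal_pos (measure_ball_pos volume (0 : E) one_pos).ne'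
    measure_ball_lt_top.ne).ne hint

/-- A continuous self-map of a Euclidean space which is the identity far away has a zero. -/
theorem Continuous.exists_eq_zero_of_eq_id {E : Type*} [NormedAddCommGroup E]
    [InnerProductSpace ℝ E] [FiniteDimensional ℝ E] {f : E → E} (hf : Continuous f) {R : ℝ}
    (hR : 0 < R) (hf1 : ∀ x, R ≤ ‖x‖ → f x = x) : ∃ x, f x = 0 := by
  by_contra! hne
  obtain ⟨g, hg, hgf, -, hgs⟩ := (hf.sub continuous_id).exists_contDiff_approx_and_eqOn 1
    hf.norm (fun x => norm_pos_iff.2 (hne x)) isClosed_empty (U := ∅) (by simp)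
    (contDiffOn_empty)
  have hg0 : ∀ x, g x + x ≠ 0 := by
    intro x h
    have h1 := hgf x
    rw [dist_eq_norm, eq_neg_of_add_eq_zero_left h] at h1
    rw [Pi.sub_apply, id, show -x - (f x - x) = -f x by abel, norm_neg] at h1
    exact h1.false
  have hgR : ∀ x, R ≤ ‖x‖ → g x = 0 := by
    intro x hx
    by_contra h
    exact hgs h (by simp [hf1 x hx])
  set k : E → E := fun x => g (R • x) + R • x
  have hk : ContDiff ℝ 1 k := by
    have : ContDiff ℝ 1 g := hg
    fun_prop
  have hk0 : ∀ x, k x ≠ 0 := fun x => hg0 _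
  refine not_contDiff_retraction_sphere (r := fun x => ‖k x‖⁻¹ • k x)
    (((hk.norm ℝ hk0).inv fun x => norm_ne_zero_iff.2 (hk0 x)).smul hk) (fun x => ?_)
    fun x hx => ?_
  · rw [norm_smul, norm_inv, norm_norm, inv_mul_cancel₀ (norm_ne_zero_iff.2 (hk0 x))]
  · have h1 : k x = R • x := by
      simp only [k]
      rw [hgR, zero_add]
      rw [norm_smul, hx, mul_one, Real.norm_of_nonneg hR.le]
    simp only [h1, norm_smul, hx, mul_one, Real.norm_of_nonneg hR.le]
    rw [smul_smul, inv_mul_cancel₀ hR.ne', one_smul]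

/-- A self-map of the unit sphere homotopic to the identity is surjective. -/
theorem exists_eq_of_homotopy_id {E : Type*} [NormedAddCommGroup E]
    [InnerProductSpace ℝ E] [FiniteDimensional ℝ E] {G : E → ℝ → E}
    (hG : ContinuousOn (Function.uncurry G) (Metric.sphere 0 1 ×ˢ Set.Icc 0 1))
    (hG1 : ∀ x, ‖x‖ = 1 → ∀ t ∈ Set.Icc (0 : ℝ) 1, ‖G x t‖ = 1)
    (hG0 : ∀ x, ‖x‖ = 1 → G x 0 = x) (e : E) (he : ‖e‖ = 1) :
    ∃ x, ‖x‖ = 1 ∧ G x 1 = e := by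
  by_contra! hne
  set c : E → ℝ := fun x => max 0 (min 1 (2 - ‖x‖))
  have hc : Continuous c := by fun_prop
  have hcI : ∀ x, c x ∈ Set.Icc (0 : ℝ) 1 := fun x => ⟨le_max_left _ _, by simp [c]⟩
  set F : E → E := fun x => ‖x‖ • G (‖x‖⁻¹ • x) (c x) - max 0 (1 - ‖x‖) • e
  have hnorm : ∀ x : E, x ≠ 0 → ‖‖x‖⁻¹ • x‖ = 1 := fun x hx => by
    rw [norm_smul, norm_inv, norm_norm, inv_mul_cancel₀ (norm_ne_zero_iff.2 hx)]
  have hFcont : Continuous F := by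
    refine Continuous.sub ?_ (by fun_prop)
    rw [continuous_iff_continuousAt]
    intro x
    by_cases hx : x = 0
    · subst hx
      have hn : ∀ x : E, ‖‖x‖ • G (‖x‖⁻¹ • x) (c x)‖ = ‖x‖ := by
        intro x
        by_cases hx : x = 0
        · simp [hx]
        · rw [norm_smul, hG1 _ (hnorm x hx) _ (hcI x), norm_norm, mul_one]
      rw [ContinuousAt, norm_zero, zero_smul]
      refine squeeze_zero_norm (a := fun x => ‖x‖) (fun x => (hn x).le) ?_
      simpa using (continuous_norm (E := E)).tendsto 0
    · have h1 : ContinuousOn (fun x => Function.uncurry G (‖x‖⁻¹ • x, c x)) {0}ᶜ := by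
        refine hG.comp ?_ fun y hy => ⟨mem_sphere_zero_iff_norm.2 (hnorm y hy), hcI y⟩
        refine ContinuousOn.prodMk ?_ hc.continuousOn
        exact (continuous_norm.continuousOn.inv₀ fun y hy => norm_ne_zero_iff.2 hy).smul
          continuousOn_id
      exact continuous_norm.continuousAt.smul (h1.continuousAt (isOpen_compl_singleton.mem_nhds hx))
  obtain ⟨x, hx⟩ := hFcont.exists_eq_zero_of_eq_id (R := 2) two_pos (by
    intro x hx
    have hx' : x ≠ 0 := by rintro rfl; norm_num at hx
    have h1 : c x = 0 := max_eq_left ((min_le_right _ _).trans (by linarith))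
    simp only [F, h1]
    rw [hG0 _ (hnorm x hx'), smul_smul, mul_inv_cancel₀ (norm_ne_zero_iff.2 hx'), one_smul,
      max_eq_left (by linarith), zero_smul, sub_zero])
  have h2 : ‖x‖ • G (‖x‖⁻¹ • x) (c x) = max 0 (1 - ‖x‖) • e := sub_eq_zero.1 hx
  by_cases hx' : x = 0
  · simp only [hx', norm_zero, zero_smul, sub_zero, max_eq_right zero_le_one, one_smul] at h2
    rw [← h2, norm_zero] at he
    exact zero_ne_one he
  have h3 := congrArg norm h2
  rw [norm_smul, norm_smul, he, hG1 _ (hnorm x hx') _ (hcI x), norm_norm, mul_one, mul_one,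
    Real.norm_of_nonneg (le_max_left _ _)] at h3
  have hpos := norm_pos_iff.2 hx'
  have h4 : ‖x‖ = 1 / 2 := by
    rcases max_cases 0 (1 - ‖x‖) with h | h <;> linarith
  have h5 : c x = 1 := by
    simp only [c, h4]; norm_num
  rw [← h3, h5] at h2
  exact hne _ (hnorm x hx') (smul_right_injective E hpos.ne' h2)

/-- The time `r` moved towards `0` by at most `h`. -/
noncomputable def timeDelay (h r : ℝ) : ℝ := r - max (-h) (min h r)

theorem continuous_timeDelay (h : ℝ) : Continuous (timeDelay h) := by
  unfold timeDelay; fun_prop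

theorem timeDelay_neg {h : ℝ} (hh : 0 ≤ h) (r : ℝ) : timeDelay h (-r) = -timeDelay h r := by
  unfold timeDelay
  rcases max_cases (-h) (min h r) with h1 | h1 <;> rcases min_cases h r with h2 | h2 <;>
  rcases max_cases (-h) (min h (-r)) with h3 | h3 <;> rcases min_cases h (-r) with h4 | h4 <;>
  linarith

theorem abs_timeDelay {h : ℝ} (hh : 0 ≤ h) (r : ℝ) : |timeDelay h r| = max 0 (|r| - h) := by
  unfold timeDelay
  rcases max_cases (-h) (min h r) with h1 | h1 <;> rcases min_cases h r with h2 | h2 <;>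
  rcases abs_cases r with h3 | h3 <;> rcases abs_cases (r - max (-h) (min h r)) with h4 | h4 <;>
  rcases max_cases 0 (|r| - h) with h5 | h5 <;> linarith

theorem abs_sub_timeDelay_le {h : ℝ} (hh : 0 ≤ h) (r : ℝ) : |r - timeDelay h r| ≤ h := by
  unfold timeDelay
  rw [sub_sub_cancel, abs_le]
  exact ⟨le_max_left _ _, max_le (by linarith) (min_le_left _ _)⟩

section DelayIter

variable {E : Type*} [NormedAddCommGroup E] [NormedSpace ℝ E]

/-- Iterates for the delay equation `ü t = F (u (timeDelay h t))`, starting at rest from `p`. -/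
noncomputable def delayIter (F : E → E) (h : ℝ) : ℕ → E → ℝ → E
  | 0 => fun p _ => p
  | k + 1 => fun p t => p + ∫ s in (0 : ℝ)..t, ∫ r in (0 : ℝ)..s,
      F (delayIter F h k p (timeDelay h r))

variable {F : E → E} {h : ℝ}

theorem delayIter_neg (hh : 0 ≤ h) (k : ℕ) (p : E) (t : ℝ) :
    delayIter F h k p (-t) = delayIter F h k p t := by
  induction k generalizing t with
  | zero => rfl
  | succ k ih =>
    simp only [delayIter]
    congr 1
    have h1 : ∀ s : ℝ, ∫ r in (0 : ℝ)..(-s), F (delayIter F h k p (timeDelay h r)) =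
        -∫ r in (0 : ℝ)..s, F (delayIter F h k p (timeDelay h r)) := by
      intro s
      have h2 := intervalIntegral.integral_comp_neg (a := 0) (b := -s)
        (fun r => F (delayIter F h k p (timeDelay h r)))
      simp only [timeDelay_neg hh, ih, neg_neg, neg_zero] at h2
      rw [h2, intervalIntegral.integral_symm]
    have h3 := intervalIntegral.integral_comp_neg (a := 0) (b := -t)
      (fun s => ∫ r in (0 : ℝ)..s, F (delayIter F h k p (timeDelay h r)))
    simp only [h1, neg_neg, neg_zero, intervalIntegral.integral_neg] at h3
    rw [intervalIntegral.integral_symm t 0, ← h3, neg_neg]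

theorem delayIter_succ_eq (hh : 0 ≤ h) (k : ℕ) (p : E) {t : ℝ} (ht : |t| ≤ k * h) :
    delayIter F h (k + 1) p t = delayIter F h k p t := by
  induction k generalizing t with
  | zero =>
    have : t = 0 := by simpa using ht
    simp [delayIter, this]
  | succ k ih =>
    change p + _ = p + _
    congr 1
    refine intervalIntegral.integral_congr fun s hs => ?_
    refine intervalIntegral.integral_congr fun r hr => ?_
    have hs' : |s| ≤ |t| := by simpa using Set.abs_sub_left_of_mem_uIcc hs
    have hr' : |r| ≤ |s| := by simpa using Set.abs_sub_left_of_mem_uIcc hr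
    have hkh : 0 ≤ k * h := by positivity
    rw [ih]
    rw [abs_timeDelay hh]
    refine max_le hkh ?_
    push_cast at ht
    linarith

theorem delayIter_zero_right (k : ℕ) (p : E) : delayIter F h k p 0 = p := by
  cases k <;> simp [delayIter]

theorem continuous_delayIter (hF : Continuous F) (k : ℕ) :
    Continuous (Function.uncurry (delayIter F h k)) := by
  induction k with
  | zero => exact continuous_fst
  | succ k ih =>
    have h1 : Continuous fun x : E × ℝ => ∫ r in (0 : ℝ)..x.2,
        F (delayIter F h k x.1 (timeDelay h r)) := by
      refine intervalIntegral.continuous_parametric_intervalIntegral_of_continuous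
        (f := fun (x : E × ℝ) r => F (delayIter F h k x.1 (timeDelay h r))) ?_ continuous_snd
      exact hF.comp (ih.comp (continuous_fst.fst.prodMk
        ((continuous_timeDelay h).comp continuous_snd)))
    refine continuous_fst.add ?_
    refine intervalIntegral.continuous_parametric_intervalIntegral_of_continuous
      (f := fun (x : E × ℝ) s => ∫ r in (0 : ℝ)..s, F (delayIter F h k x.1 (timeDelay h r))) ?_
      continuous_snd
    exact h1.comp (continuous_fst.fst.prodMk continuous_snd)

end DelayIter

section

variable {E : Type*} [NormedAddCommGroup E] [NormedSpace ℝ E]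

theorem norm_sub_le_of_hasDerivAt_le {f f' : ℝ → E} {T C : ℝ}
    (hf : ∀ t, HasDerivAt f (f' t) t) (hC : ∀ t, |t| ≤ T → ‖f' t‖ ≤ C) {s t : ℝ} (hs : |s| ≤ T)
    (ht : |t| ≤ T) : ‖f t - f s‖ ≤ C * |t - s| :=
  (convex_Icc (-T) T).norm_image_sub_le_of_norm_hasDerivWithin_le
    (fun x _ => (hf x).hasDerivWithinAt) (fun x hx => hC x (abs_le.2 hx)) (abs_le.1 hs)
    (abs_le.1 ht)

theorem norm_le_of_second_deriv_le {u v a : ℝ → E} {M : ℝ}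
    (hu : ∀ t, HasDerivAt u (v t) t) (hv : ∀ t, HasDerivAt v (a t) t) (hv0 : v 0 = 0)
    (ha : ∀ t, ‖a t‖ ≤ M) (t : ℝ) : ‖v t‖ ≤ M * |t| ∧ ‖u t - u 0‖ ≤ M * t ^ 2 := by
  have h1 : ∀ t, ‖v t‖ ≤ M * |t| := fun t => by
    simpa [hv0] using norm_sub_le_of_hasDerivAt_le hv (fun s _ => ha s) (s := 0) (t := t)
      (T := |t|) (by simp) le_rfl
  refine ⟨h1 t, ?_⟩
  have hM : 0 ≤ M := (norm_nonneg _).trans (ha 0)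
  have := norm_sub_le_of_hasDerivAt_le hu (C := M * |t|) (T := |t|) (s := 0) (t := t)
    (fun s hs => (h1 s).trans (by gcongr)) (by simp) le_rfl
  rwa [sub_zero, mul_assoc, abs_mul_abs_self, ← sq] at this

/-- Continuous families of approximate solutions of `ü = F u` starting at rest. -/
theorem exists_approx_solution_family [FiniteDimensional ℝ E] {F : E → E} (hF : Continuous F)
    {M : ℝ} (hM : ∀ x, ‖F x‖ ≤ M) (R : ℝ) {T ε : ℝ} (hT : 0 < T) (hε : 0 < ε) :
    ∃ u v a : E → ℝ → E, Continuous (Function.uncurry u) ∧ (∀ p, u p 0 = p) ∧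
      (∀ p, v p 0 = 0) ∧ (∀ p t, HasDerivAt (u p) (v p t) t) ∧
      (∀ p t, HasDerivAt (v p) (a p t) t) ∧ (∀ p t, u p (-t) = u p t) ∧
      (∀ p t, ‖a p t‖ ≤ M) ∧
      ∀ p, ‖p‖ ≤ R → ∀ t, |t| ≤ T → ‖a p t - F (u p t)‖ ≤ ε := by
  have hM0 : 0 ≤ M := (norm_nonneg _).trans (hM 0)
  have hcpt : IsCompact (Metric.closedBall (0 : E) (R + M * T ^ 2)) := isCompact_closedBall _ _
  obtain ⟨δ, hδ, hδF⟩ := Metric.uniformContinuousOn_iff.1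
    (hcpt.uniformContinuousOn_of_continuous hF.continuousOn) ε hε
  set h : ℝ := δ / (2 * (M * T + 1)) with hh
  have hh0 : 0 < h := by positivity
  obtain ⟨k, hk⟩ := exists_nat_ge (T / h)
  have hkT : T ≤ k * h := (div_le_iff₀ hh0).1 hk
  set a : E → ℝ → E := fun p t => F (delayIter F h k p (timeDelay h t))
  set v : E → ℝ → E := fun p t => ∫ r in (0 : ℝ)..t, a p r
  set u : E → ℝ → E := delayIter F h (k + 1)
  have hac : ∀ p, Continuous (a p) := fun p =>
    hF.comp ((continuous_delayIter hF k).comp (continuous_const.prodMk (continuous_timeDelay h)))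
  have hv : ∀ p t, HasDerivAt (v p) (a p t) t := fun p t =>
    intervalIntegral.integral_hasDerivAt_right ((hac p).intervalIntegrable _ _)
      ((hac p).stronglyMeasurableAtFilter _ _) (hac p).continuousAt
  have hvc : ∀ p, Continuous (v p) := fun p =>
    continuous_iff_continuousAt.2 fun t => (hv p t).continuousAt
  have hu : ∀ p t, HasDerivAt (u p) (v p t) t := fun p t =>
    (intervalIntegral.integral_hasDerivAt_right ((hvc p).intervalIntegrable _ _)
      ((hvc p).stronglyMeasurableAtFilter _ _) (hvc p).continuousAt).const_add p
  have hu0 : ∀ p, u p 0 = p := delayIter_zero_right _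
  have hv0 : ∀ p, v p 0 = 0 := fun p => intervalIntegral.integral_same
  have ha : ∀ p t, ‖a p t‖ ≤ M := fun p t => hM _
  refine ⟨u, v, a, continuous_delayIter hF _, hu0, hv0, hu, hv, delayIter_neg hh0.le _, ha, ?_⟩
  intro p hp t ht
  have hd : |timeDelay h t| ≤ T := by
    rw [abs_timeDelay hh0.le]
    exact max_le hT.le (by linarith)
  have hmem : ∀ s, |s| ≤ T → u p s ∈ Metric.closedBall (0 : E) (R + M * T ^ 2) := by
    intro s hs
    rw [mem_closedBall_zero_iff]
    have h1 := (norm_le_of_second_deriv_le (hu p) (hv p) (hv0 p) (ha p) s).2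
    have h2 : s ^ 2 ≤ T ^ 2 := sq_le_sq' (by linarith [(abs_le.1 hs).1]) (abs_le.1 hs).2
    rw [hu0] at h1
    calc ‖u p s‖ ≤ ‖p‖ + ‖u p s - p‖ := norm_le_insert' _ _
      _ ≤ R + M * T ^ 2 := add_le_add hp (h1.trans (by gcongr))
  have heq : a p t = F (u p (timeDelay h t)) := by
    simp only [a, u]
    rw [delayIter_succ_eq hh0.le k p (hd.trans hkT)]
  rw [heq, ← dist_eq_norm]
  refine (hδF _ (hmem _ hd) _ (hmem _ ht) ?_).le
  rw [dist_comm, dist_eq_norm]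
  have h3 := norm_sub_le_of_hasDerivAt_le (hu p) (C := M * T) (T := T)
    (fun s hs => (norm_le_of_second_deriv_le (hu p) (hv p) (hv0 p) (ha p) s).1.trans
      (by gcongr)) hd ht
  calc ‖u p t - u p (timeDelay h t)‖ ≤ M * T * h :=
        h3.trans (by gcongr; exact abs_sub_timeDelay_le hh0.le t)
    _ < δ := by
      rw [hh, mul_div_assoc', div_lt_iff₀ (by positivity)]
      nlinarith [mul_nonneg hM0 hT.le]

open Filter Topology in
theorem hasDerivAt_of_tendsto_of_deriv_near {l : Filter ℕ} [l.NeBot] {y y' : ℕ → ℝ → E}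
    {f : ℝ → E} {f' : E} {t : ℝ} (hy : ∀ n s, HasDerivAt (y n) (y' n s) s)
    (hf : ∀ s, Tendsto (fun n => y n s) l (𝓝 (f s)))
    (hy' : ∀ η > 0, ∃ δ > 0, ∀ᶠ n in l, ∀ s, |s - t| < δ → ‖y' n s - f'‖ ≤ η) :
    HasDerivAt f f' t := by
  rw [hasDerivAt_iff_isLittleO, Asymptotics.isLittleO_iff]
  intro η hη
  obtain ⟨δ, hδ, hn⟩ := hy' η hη
  filter_upwards [Metric.ball_mem_nhds t hδ] with s hs
  have hlim : Tendsto (fun n => ‖y n s - y n t - (s - t) • f'‖) l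
      (𝓝 ‖f s - f t - (s - t) • f'‖) :=
    (((hf s).sub (hf t)).sub tendsto_const_nhds).norm
  refine le_of_tendsto hlim ?_
  filter_upwards [hn] with n hn
  have := (convex_ball t δ).norm_image_sub_le_of_norm_hasDerivWithin_le
    (f := fun s => y n s - s • f') (f' := fun s => y' n s - (1 : ℝ) • f')
    (fun x _ => ((hy n x).sub ((hasDerivAt_id x).smul_const f')).hasDerivWithinAt)
    (fun x hx => by rw [one_smul]; exact hn x (by simpa [Real.dist_eq] using hx))
    (Metric.mem_ball_self hδ) hs
  rwa [sub_sub_sub_comm, ← sub_smul] at this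

open Filter Topology in
/-- Approximate solutions of `ü = F u` starting at rest subconverge to a solution. -/
theorem exists_solution_of_approx_solutions [FiniteDimensional ℝ E] {F : E → E}
    (hF : Continuous F) {M R : ℝ} {u v a : ℕ → ℝ → E} (hu : ∀ n t, HasDerivAt (u n) (v n t) t)
    (hv : ∀ n t, HasDerivAt (v n) (a n t) t) (hv0 : ∀ n, v n 0 = 0) (hu0 : ∀ n, ‖u n 0‖ ≤ R)
    (ha : ∀ n t, ‖a n t‖ ≤ M)
    (happ : ∀ T, ∀ η > 0, ∀ᶠ n in atTop, ∀ t, |t| ≤ T → ‖a n t - F (u n t)‖ ≤ η) :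
    ∃ (l : Filter ℕ) (U W : ℝ → E), l.NeBot ∧ l ≤ atTop ∧
      (∀ t, Tendsto (fun n => u n t) l (𝓝 (U t))) ∧ W 0 = 0 ∧
      (∀ t, HasDerivAt U (W t) t) ∧ ∀ t, HasDerivAt W (F (U t)) t := by
  have hM0 : 0 ≤ M := (norm_nonneg _).trans (ha 0 0)
  have hvb : ∀ n t, ‖v n t‖ ≤ M * |t| := fun n t =>
    (norm_le_of_second_deriv_le (hu n) (hv n) (hv0 n) (ha n) t).1
  have hub : ∀ n t, ‖u n t‖ ≤ R + M * t ^ 2 := fun n t => by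
    have h1 := (norm_le_of_second_deriv_le (hu n) (hv n) (hv0 n) (ha n) t).2
    calc ‖u n t‖ ≤ ‖u n 0‖ + ‖u n t - u n 0‖ := norm_le_insert' _ _
      _ ≤ R + M * t ^ 2 := add_le_add (hu0 n) h1
  have hlim : ∀ (f : ℕ → E) (C : ℝ), (∀ n, ‖f n‖ ≤ C) →
      ∃ x, Tendsto f (hyperfilter ℕ : Filter ℕ) (𝓝 x) := by
    intro f C hf
    obtain ⟨x, -, hx⟩ := (isCompact_closedBall (0 : E) C).ultrafilter_le_nhds
      ((hyperfilter ℕ).map f) (by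
        exact tendsto_principal.2
          (Eventually.of_forall fun n => mem_closedBall_zero_iff.2 (hf n)))
    exact ⟨x, hx⟩
  choose U hU using fun t => hlim (fun n => u n t) _ (fun n => hub n t)
  choose W hW using fun t => hlim (fun n => v n t) _ (fun n => hvb n t)
  have hle : (hyperfilter ℕ : Filter ℕ) ≤ atTop := Nat.hyperfilter_le_atTop
  refine ⟨hyperfilter ℕ, U, W, inferInstance, hle, hU, ?_, ?_, ?_⟩
  · exact tendsto_nhds_unique (hW 0) (by simp [hv0])
  · intro t
    refine hasDerivAt_of_tendsto_of_deriv_near hu hU fun η hη => ?_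
    refine ⟨η / (2 * (M + 1)), by positivity, ?_⟩
    filter_upwards [(hW t).eventually (Metric.ball_mem_nhds _ (half_pos hη))] with n hn s hs
    rw [dist_eq_norm] at hn
    have h1 := norm_sub_le_of_hasDerivAt_le (hv n) (fun s _ => ha n s) (s := t) (t := s)
      (T := max |s| |t|) (le_max_right _ _) (le_max_left _ _)
    calc ‖v n s - W t‖ ≤ ‖v n s - v n t‖ + ‖v n t - W t‖ := norm_sub_le_norm_sub_add_norm_sub _ _ _
      _ ≤ M * (η / (2 * (M + 1))) + η / 2 := by gcongr; exact h1.trans (by gcongr)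
      _ ≤ η := by
        have : M * (η / (2 * (M + 1))) ≤ η / 2 := by
          rw [mul_div_assoc', div_le_div_iff₀ (by positivity) two_pos]
          nlinarith
        linarith
  · intro t
    refine hasDerivAt_of_tendsto_of_deriv_near hv hW fun η hη => ?_
    obtain ⟨δ, hδ, hδF⟩ := Metric.continuousAt_iff.1 (hF.continuousAt (x := U t)) (η / 2)
      (half_pos hη)
    set T := |t| + 1
    have hT : 0 < T := by positivity
    refine ⟨min 1 (δ / (2 * (M * T + 1))), lt_min one_pos (by positivity), ?_⟩
    filter_upwards [(hU t).eventually (Metric.ball_mem_nhds _ (half_pos hδ)),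
      hle (happ T (η / 2) (half_pos hη))] with n hn hn2 s hs
    rw [dist_eq_norm] at hn
    have hs1 : |s| ≤ T := by
      have h2 : |s - t| < 1 := hs.trans_le (min_le_left _ _)
      have := abs_sub_abs_le_abs_sub s t
      simp only [T]; linarith
    have h1 := norm_sub_le_of_hasDerivAt_le (hu n) (C := M * T) (s := t) (t := s) (T := T)
      (fun s hs => (hvb n s).trans (by gcongr)) (by simp [T]) hs1
    have h3 : ‖u n s - U t‖ < δ := by
      calc ‖u n s - U t‖ ≤ ‖u n s - u n t‖ + ‖u n t - U t‖ :=
            norm_sub_le_norm_sub_add_norm_sub _ _ _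
        _ < M * T * (δ / (2 * (M * T + 1))) + δ / 2 := by
          refine add_lt_add_of_le_of_lt (h1.trans ?_) hn
          gcongr
          exact hs.le.trans (min_le_right _ _)
        _ ≤ δ := by
          have : M * T * (δ / (2 * (M * T + 1))) ≤ δ / 2 := by
            rw [mul_div_assoc', div_le_div_iff₀ (by positivity) two_pos]
            nlinarith [mul_nonneg hM0 hT.le]
          linarith
    have h4 := hδF (by rwa [dist_eq_norm])
    rw [dist_eq_norm] at h4
    calc ‖a n s - F (U t)‖ ≤ ‖a n s - F (u n s)‖ + ‖F (u n s) - F (U t)‖ :=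
          norm_sub_le_norm_sub_add_norm_sub _ _ _
      _ ≤ η / 2 + η / 2 := add_le_add (hn2 s hs1) h4.le
      _ = η := add_halves η

end

theorem le_of_hasDerivAt_nonneg {f f' : ℝ → ℝ} {T : ℝ} (hf : ∀ t, HasDerivAt f (f' t) t)
    (hf' : ∀ t ∈ Set.Icc 0 T, 0 ≤ f' t) {t : ℝ} (ht : t ∈ Set.Icc 0 T) : f 0 ≤ f t := by
  refine monotoneOn_of_deriv_nonneg (convex_Icc 0 T)
    (fun s _ => (hf s).continuousAt.continuousWithinAt)
    (fun s _ => (hf s).differentiableAt.differentiableWithinAt) (fun s hs => ?_)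
    ⟨le_rfl, ht.1.trans ht.2⟩ ht ht.1
  rw [(hf s).deriv]
  exact hf' s (interior_subset hs)

section

variable {E : Type*} [NormedAddCommGroup E] [InnerProductSpace ℝ E]

/-- Energy and virial estimates for approximate brake orbits of a repulsive potential. -/
theorem energy_virial_estimates [CompleteSpace E] {F : E → E} {W : E → ℝ} {M H α T ε : ℝ}
    (hW : ∀ x, HasGradientAt W (-F x) x) (hα : α ∈ Set.Ioo (0 : ℝ) 2)
    (hWF : ∀ x, W x < 2 * H → ⟪x, F x⟫_ℝ = α * W x) (hH : 0 < H) {u v a : ℝ → E}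
    (hu : ∀ t, HasDerivAt u (v t) t) (hv : ∀ t, HasDerivAt v (a t) t) (hv0 : v 0 = 0)
    (hu0 : W (u 0) = H) (ha : ∀ t, ‖a t‖ ≤ M) (hε : 0 ≤ ε)
    (happ : ∀ t, |t| ≤ T → ‖a t - F (u t)‖ ≤ ε)
    (hεs : (3 * (M * T ^ 2) + ‖u 0‖) * ε ≤ α * H / 2) {t : ℝ} (ht : t ∈ Set.Icc 0 T) :
    |1 / 2 * ‖v t‖ ^ 2 + W (u t) - H| ≤ M * T ^ 2 * ε ∧ W (u t) < 2 * H ∧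
      ‖u 0‖ ^ 2 + α * H / 2 * t ^ 2 ≤ ‖u t‖ ^ 2 := by
  have hM : 0 ≤ M := (norm_nonneg _).trans (ha 0)
  have hT : 0 ≤ T := ht.1.trans ht.2
  have hMT : 0 ≤ M * T ^ 2 := by positivity
  have hsq : ∀ s, |s| ≤ T → s ^ 2 ≤ T ^ 2 := fun s hs =>
    sq_le_sq' (by linarith [(abs_le.1 hs).1]) (abs_le.1 hs).2
  have hE : ∀ s, HasDerivAt (fun s => 1 / 2 * ‖v s‖ ^ 2 + W (u s))
      (⟪v s, a s - F (u s)⟫_ℝ) s := by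
    intro s
    have h1 := ((hv s).norm_sq).const_mul (1 / 2 : ℝ)
    have h2 := (hW (u s)).hasFDerivAt.comp_hasDerivAt s (hu s)
    refine (h1.add h2).congr_deriv ?_
    rw [inner_sub_right, InnerProductSpace.toDual_apply_apply, inner_neg_left,
      real_inner_comm (F (u s))]
    ring
  have hEb : ∀ s, |s| ≤ T → |1 / 2 * ‖v s‖ ^ 2 + W (u s) - H| ≤ M * T ^ 2 * ε := by
    intro s hs
    have h1 := norm_sub_le_of_hasDerivAt_le hE (T := T) (C := M * T * ε) (s := 0) (t := s)
      (fun r hr => by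
        refine (norm_inner_le_norm _ _).trans ?_
        have := (norm_le_of_second_deriv_le hu hv hv0 ha r).1
        gcongr
        · exact this.trans (by gcongr)
        · exact happ r hr) (by simpa using hT) hs
    simp only [hv0, hu0, norm_zero, Real.norm_eq_abs, sub_zero] at h1
    norm_num at h1
    norm_num
    refine h1.trans ?_
    calc M * T * ε * |s| ≤ M * T * ε * T := by gcongr
      _ = M * T ^ 2 * ε := by ring
  have hsmall : M * T ^ 2 * ε ≤ H / 3 := by
    have : 0 ≤ ‖u 0‖ * ε := by positivity
    nlinarith [hα.2]
  have hWlt : ∀ s, |s| ≤ T → W (u s) < 2 * H := by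
    intro s hs
    have := (abs_le.1 (hEb s hs)).2
    nlinarith [sq_nonneg ‖v s‖]
  have hJ1 : ∀ s, HasDerivAt (fun s => 2 * ⟪u s, v s⟫_ℝ - α * H * s)
      (2 * (⟪u s, a s⟫_ℝ + ⟪v s, v s⟫_ℝ) - α * H) s := fun s =>
    ((((hu s).inner ℝ (hv s)).const_mul 2).sub ((hasDerivAt_id s).const_mul (α * H))).congr_deriv
      (by ring)
  have hJ1n : ∀ s ∈ Set.Icc 0 T, 0 ≤ 2 * (⟪u s, a s⟫_ℝ + ⟪v s, v s⟫_ℝ) - α * H := by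
    intro s hs
    have hs' : |s| ≤ T := by rw [abs_of_nonneg hs.1]; exact hs.2
    have h1 : ⟪u s, a s⟫_ℝ = α * W (u s) + ⟪u s, a s - F (u s)⟫_ℝ := by
      rw [inner_sub_right, hWF _ (hWlt s hs')]; ring
    have h2 : ‖u s‖ ≤ ‖u 0‖ + M * T ^ 2 := by
      have := (norm_le_of_second_deriv_le hu hv hv0 ha s).2
      calc ‖u s‖ ≤ ‖u 0‖ + ‖u s - u 0‖ := norm_le_insert' _ _
        _ ≤ _ := add_le_add le_rfl (this.trans (mul_le_mul_of_nonneg_left (hsq s hs') hM))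
    have h3 : -((‖u 0‖ + M * T ^ 2) * ε) ≤ ⟪u s, a s - F (u s)⟫_ℝ := by
      refine neg_le_of_abs_le ((abs_real_inner_le_norm _ _).trans ?_)
      gcongr
      exact happ s hs'
    have h4 := (abs_le.1 (hEb s hs')).1
    have h5 := (abs_le.1 (hEb s hs')).2
    rw [h1, real_inner_self_eq_norm_sq]
    have h6 : 0 ≤ M * T ^ 2 * ε := by positivity
    nlinarith [hα.1, hα.2, mul_nonneg (sub_nonneg.2 hα.2.le) (sq_nonneg ‖v s‖),
      mul_nonneg hα.1.le (sub_nonneg.2 h4), mul_nonneg (sub_nonneg.2 hα.2.le) h6]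
  have hJ2 : ∀ s, HasDerivAt (fun s => ‖u s‖ ^ 2 - α * H / 2 * s ^ 2)
      (2 * ⟪u s, v s⟫_ℝ - α * H * s) s := fun s =>
    ((hu s).norm_sq.sub ((hasDerivAt_pow 2 s).const_mul (α * H / 2))).congr_deriv
      (by push_cast; ring)
  have hJ2n : ∀ s ∈ Set.Icc 0 T, 0 ≤ 2 * ⟪u s, v s⟫_ℝ - α * H * s := by
    intro s hs
    simpa [hv0] using le_of_hasDerivAt_nonneg hJ1 hJ1n hs
  have ht' : |t| ≤ T := by rw [abs_of_nonneg ht.1]; exact ht.2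
  refine ⟨hEb t ht', hWlt t ht', ?_⟩
  have := le_of_hasDerivAt_nonneg hJ2 hJ2n ht
  nlinarith

end

section

variable {E : Type*} [NormedAddCommGroup E] [NormedSpace ℝ E]

theorem norm_sub_norm_smul_le {x e : E} (he : ‖e‖ = 1) {C c : ℝ} (hc : 0 ≤ c)
    (h : ‖x - c • e‖ ≤ C) : ‖x - ‖x‖ • e‖ ≤ 2 * C := by
  have h1 : |c - ‖x‖| ≤ ‖x - c • e‖ := by
    have := abs_norm_sub_norm_le x (c • e)
    rwa [norm_smul, he, mul_one, Real.norm_of_nonneg hc, abs_sub_comm] at this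
  calc ‖x - ‖x‖ • e‖ = ‖(x - c • e) + (c - ‖x‖) • e‖ := by rw [sub_smul]; congr 1; abel
    _ ≤ ‖x - c • e‖ + |c - ‖x‖| := by
      refine (norm_add_le _ _).trans ?_
      rw [norm_smul, he, mul_one, Real.norm_eq_abs]
    _ ≤ 2 * C := by linarith

/-- An integrably decaying acceleration keeps a trajectory ending on a ray close to that ray. -/
theorem norm_sub_norm_smul_le_of_deriv_decay {u v a : ℝ → E} {e : E} {K R β ε T c : ℝ}
    (hu : ∀ t, HasDerivAt u (v t) t) (hv : ∀ t, HasDerivAt v (a t) t) (he : ‖e‖ = 1)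
    (hβ : 1 < β) (hK : 0 ≤ K) (hR : ‖u 0‖ ≤ R) (hε : 0 ≤ ε) (hεT : ε * T ^ 2 ≤ 1)
    (ha : ∀ t ∈ Set.Icc 0 T, ‖a t‖ ≤ K * (1 + t) ^ (-(β + 1)) + ε) (hc : 0 ≤ c)
    (huT : u T = c • e) {t : ℝ} (ht : t ∈ Set.Icc 0 T) :
    ‖u t - ‖u t‖ • e‖ ≤ 2 * (R + K / (β - 1) + 1) := by
  have hβ' : 0 < β - 1 := by linarith
  have hR0 : 0 ≤ R := (norm_nonneg _).trans hR
  set C := R + K / (β - 1) + 1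
  have hRC : R ≤ C := by
    have : 0 ≤ K / (β - 1) := by positivity
    simp only [C]; linarith
  have hC0 : 0 ≤ C := hR0.trans hRC
  have hw : ∀ t, HasDerivAt (fun t => t • v t - u t) (t • a t) t := fun t =>
    (((hasDerivAt_id t).smul (hv t)).sub (hu t)).congr_deriv (by simp)
  have hB : ∀ s : ℝ, 0 ≤ s → HasDerivAt
      (fun t => R + K / (β - 1) * (1 - (1 + t) ^ (-(β - 1))) + ε / 2 * t ^ 2)
      (K * (1 + s) ^ (-β) + ε * s) s := by
    intro s hs
    have h0 : 0 < 1 + s := by linarith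
    have h1 := (((hasDerivAt_id s).const_add 1).rpow_const (p := -(β - 1)) (Or.inl h0.ne'))
    have h2 := (((h1.const_sub 1).const_mul (K / (β - 1))).const_add R).add
      ((hasDerivAt_pow 2 s).const_mul (ε / 2))
    refine h2.congr_deriv ?_
    rw [show -(β - 1) - 1 = -β by ring]
    simp only [id]
    field_simp
    push_cast
    ring
  have hwb : ∀ t ∈ Set.Icc 0 T, ‖t • v t - u t‖ ≤ C := by
    intro t ht
    have h1 := image_norm_le_of_norm_deriv_right_le_deriv_boundary' (a := 0) (b := T)
      (f := fun t => t • v t - u t) (f' := fun t => t • a t)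
      (B := fun t => R + K / (β - 1) * (1 - (1 + t) ^ (-(β - 1))) + ε / 2 * t ^ 2)
      (B' := fun t => K * (1 + t) ^ (-β) + ε * t)
      (fun s _ => (hw s).continuousAt.continuousWithinAt)
      (fun s _ => (hw s).hasDerivWithinAt) (by simpa using hR)
      (fun s hs => (hB s hs.1).continuousAt.continuousWithinAt)
      (fun s hs => (hB s hs.1).hasDerivWithinAt)
      (fun s hs => by
        have h0 : 0 < 1 + s := by linarith [hs.1]
        rw [norm_smul, Real.norm_of_nonneg hs.1]
        calc s * ‖a s‖ ≤ s * (K * (1 + s) ^ (-(β + 1)) + ε) :=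
              mul_le_mul_of_nonneg_left (ha s ⟨hs.1, hs.2.le⟩) hs.1
          _ ≤ (1 + s) * (K * (1 + s) ^ (-(β + 1))) + ε * s := by
            have : 0 ≤ K * (1 + s) ^ (-(β + 1)) := by positivity
            nlinarith
          _ = K * (1 + s) ^ (-β) + ε * s := by
            rw [show -β = -(β + 1) + 1 by ring, Real.rpow_add_one h0.ne']
            ring) ht
    refine h1.trans ?_
    have h2 : 0 ≤ (1 + t) ^ (-(β - 1)) := Real.rpow_nonneg (by linarith [ht.1]) _
    have h3 : K / (β - 1) * (1 - (1 + t) ^ (-(β - 1))) ≤ K / (β - 1) :=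
      mul_le_of_le_one_right (by positivity) (by linarith)
    have h4 : ε / 2 * t ^ 2 ≤ 1 := by
      have : t ^ 2 ≤ T ^ 2 := pow_le_pow_left₀ ht.1 ht.2 2
      nlinarith [sq_nonneg t]
    simp only [C]
    linarith
  rcases ht.1.eq_or_lt with h0 | h0
  · subst h0
    exact norm_sub_norm_smul_le he le_rfl (by simpa using hR.trans hRC)
  have hT0 : 0 < T := h0.trans_le ht.2
  have hz : ∀ s, 0 < s → HasDerivAt (fun s => s⁻¹ • u s) ((s ^ 2)⁻¹ • (s • v s - u s)) s := by
    intro s hs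
    refine ((hasDerivAt_inv hs.ne').smul (hu s)).congr_deriv ?_
    rw [smul_sub, smul_smul, neg_smul, sub_eq_add_neg]
    congr 2
    field_simp
  have h1 := image_norm_le_of_norm_deriv_right_le_deriv_boundary' (a := t) (b := T)
      (f := fun s => s⁻¹ • u s - t⁻¹ • u t) (f' := fun s => (s ^ 2)⁻¹ • (s • v s - u s))
      (B := fun s => C * (t⁻¹ - s⁻¹)) (B' := fun s => C * (s ^ 2)⁻¹)
      (fun s hs => (((hz s (h0.trans_le hs.1)).sub_const _).continuousAt).continuousWithinAt)
      (fun s hs => ((hz s (h0.trans_le hs.1)).sub_const _).hasDerivWithinAt) (by simp)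
      (fun s hs => by
        have : s ≠ 0 := (h0.trans_le hs.1).ne'
        refine ContinuousAt.continuousWithinAt ?_
        fun_prop (disch := assumption))
      (fun s hs => by
        have : s ≠ 0 := (h0.trans_le hs.1).ne'
        exact ((((hasDerivAt_inv this).const_sub _).const_mul C).congr_deriv
          (by ring)).hasDerivWithinAt)
      (fun s hs => by
        have : 0 < s := h0.trans_le hs.1
        rw [norm_smul, Real.norm_of_nonneg (by positivity), mul_comm]
        gcongr
        exact hwb s ⟨this.le, hs.2.le⟩) (Set.right_mem_Icc.2 ht.2)
  refine norm_sub_norm_smul_le he (c := t * T⁻¹ * c) (by positivity) ?_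
  rw [huT, smul_smul] at h1
  calc ‖u t - (t * T⁻¹ * c) • e‖ = ‖t • ((T⁻¹ * c) • e - t⁻¹ • u t)‖ := by
        rw [norm_sub_rev, smul_sub, smul_smul, smul_smul, mul_inv_cancel₀ h0.ne', one_smul,
          mul_assoc]
    _ ≤ t * (C * (t⁻¹ - T⁻¹)) := by
        rw [norm_smul, Real.norm_of_nonneg h0.le]; gcongr
    _ ≤ C := by
        have : t * (C * (t⁻¹ - T⁻¹)) = C * (1 - t * T⁻¹) := by
          field_simp
        rw [this]
        exact mul_le_of_le_one_right hC0 (sub_le_self _ (by positivity))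

end

theorem exists_truncation {H : ℝ} (hH : 0 < H) : ∃ ψ χ : ℝ → ℝ, Continuous χ ∧
    (∀ s, 0 ≤ χ s) ∧ (∀ s, χ s ≤ 1) ∧ (∀ s, HasDerivAt ψ (χ s) s) ∧
    (∀ s ≤ 2 * H, ψ s = s) ∧ (∀ s ≤ 2 * H, χ s = 1) ∧ (∀ s, 3 * H ≤ s → ψ s = ψ (3 * H)) ∧
    (∀ s, 3 * H ≤ s → χ s = 0) ∧ ∀ s, 2 * H ≤ s → 2 * H ≤ ψ s := by
  set χ : ℝ → ℝ := fun s => max 0 (min 1 (3 - s / H)) with hχ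
  have hc : Continuous χ := by fun_prop
  have h0 : ∀ s, 0 ≤ χ s := fun s => le_max_left _ _
  have hone : ∀ s ≤ 2 * H, χ s = 1 := fun s hs => by
    have : s / H ≤ 2 := by rwa [div_le_iff₀ hH]
    simp only [hχ]
    rw [min_eq_left (by linarith), max_eq_right zero_le_one]
  have hzero : ∀ s, 3 * H ≤ s → χ s = 0 := fun s hs => by
    have : 3 ≤ s / H := by rwa [le_div_iff₀ hH]
    exact max_eq_left ((min_le_right _ _).trans (by linarith))
  refine ⟨fun s => 2 * H + ∫ r in (2 * H)..s, χ r, χ, hc, h0,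
    fun s => max_le zero_le_one (min_le_left _ _),
    fun s => (hc.integral_hasStrictDerivAt (2 * H) s).hasDerivAt.const_add _,
    fun s hs => ?_, hone, fun s hs => ?_, hzero, fun s hs => ?_⟩
  · have : ∫ r in (2 * H)..s, χ r = ∫ r in (2 * H)..s, (1 : ℝ) :=
      intervalIntegral.integral_congr fun r hr => hone r (by
        rw [Set.uIcc_of_ge hs] at hr; exact hr.2)
    simp only [this, intervalIntegral.integral_const, smul_eq_mul]
    ring
  · have : ∫ r in (3 * H)..s, χ r = ∫ r in (3 * H)..s, (0 : ℝ) :=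
      intervalIntegral.integral_congr fun r hr => hzero r (by
        rw [Set.uIcc_of_le hs] at hr; exact hr.1)
    simp only
    rw [← intervalIntegral.integral_add_adjacent_intervals (b := 3 * H)
      (hc.intervalIntegrable _ _) (hc.intervalIntegrable _ _), this]
    simp
  · exact le_add_of_nonneg_right (intervalIntegral.integral_nonneg hs fun r _ => h0 r)

section

variable {E : Type*} [NormedAddCommGroup E] [InnerProductSpace ℝ E] [CompleteSpace E]
  {V : E → ℝ} {α : ℝ}

theorem map_smul_of_inner_gradient_eq (hV : ∀ x, x ≠ 0 → DifferentiableAt ℝ V x)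
    (hVα : ∀ x, x ≠ 0 → ⟪x, gradient V x⟫_ℝ = -α * V x) {x : E} (hx : x ≠ 0) {s : ℝ}
    (hs : 0 < s) : V (s • x) = s ^ (-α) * V x := by
  have hd : ∀ r, HasDerivAt (fun r => Real.exp (α * r) * V (Real.exp r • x)) 0 r := by
    intro r
    have hne : Real.exp r • x ≠ 0 := smul_ne_zero (Real.exp_pos r).ne' hx
    have h1 := (hV _ hne).hasGradientAt.hasFDerivAt.comp_hasDerivAt r
      ((Real.hasDerivAt_exp r).smul_const x)
    have h2 := ((hasDerivAt_id r).const_mul α).exp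
    refine (h2.mul h1).congr_deriv ?_
    rw [InnerProductSpace.toDual_apply_apply, real_inner_comm, hVα _ hne]
    simp only [id, Function.comp]
    ring
  have h1 := is_const_of_deriv_eq_zero (fun r => (hd r).differentiableAt)
    (fun r => (hd r).deriv) (Real.log s) 0
  simp only [Real.exp_log hs, mul_zero, Real.exp_zero, one_mul, one_smul] at h1
  rw [← h1, ← mul_assoc, Real.rpow_def_of_pos hs, ← Real.exp_add]
  simp [mul_comm]

theorem exists_forall_le_of_norm_le [FiniteDimensional ℝ E] (hα : 0 < α)
    (hV : ∀ x, x ≠ 0 → DifferentiableAt ℝ V x)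
    (hVα : ∀ x, x ≠ 0 → ⟪x, gradient V x⟫_ℝ = -α * V x) (hVpos : ∀ x, x ≠ 0 → 0 < V x)
    (C : ℝ) : ∃ ρ > 0, ∀ x, x ≠ 0 → ‖x‖ < ρ → C ≤ V x := by
  have := FiniteDimensional.proper_real E
  have hne : ∀ x ∈ Metric.sphere (0 : E) 1, x ≠ 0 := fun x hx =>
    ne_zero_of_mem_unit_sphere ⟨x, hx⟩
  obtain ⟨m, hm0, hm⟩ := (isCompact_sphere (0 : E) 1).exists_forall_le' (a := 0)
    (fun x hx => (hV x (hne x hx)).continuousAt.continuousWithinAt)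
    (fun x hx => hVpos x (hne x hx))
  obtain ⟨ρ, hρ, h⟩ := mem_nhdsGT_iff_exists_Ioo_subset.1
    ((tendsto_rpow_neg_nhdsGT_zero (neg_lt_zero.2 hα)).eventually_ge_atTop (C / m))
  refine ⟨ρ, hρ, fun x hx hxρ => ?_⟩
  have hx0 : 0 < ‖x‖ := norm_pos_iff.2 hx
  have hmem : ‖x‖⁻¹ • x ∈ Metric.sphere (0 : E) 1 := by
    simp [norm_smul, hx0.ne']
  have h1 := map_smul_of_inner_gradient_eq hV hVα (hne _ hmem) hx0
  rw [smul_inv_smul₀ hx0.ne'] at h1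
  have h2 : C / m ≤ ‖x‖ ^ (-α) := h ⟨hx0, hxρ⟩
  rw [div_le_iff₀ hm0] at h2
  rw [h1]
  exact h2.trans (mul_le_mul_of_nonneg_left (hm _ hmem) (by positivity))

open Classical in
/-- A singular potential, homogeneous of negative degree, can be made regular above a level. -/
theorem exists_regular_potential [FiniteDimensional ℝ E] {β M₀ r₀ H : ℝ}
    (hV : ContDiffOn ℝ 1 V {0}ᶜ) (hα : 0 < α)
    (hVα : ∀ x, x ≠ 0 → ⟪x, gradient V x⟫_ℝ = -α * V x) (hVpos : ∀ x, x ≠ 0 → 0 < V x)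
    (hβ : 0 ≤ β + 1) (hr₀ : 1 ≤ r₀)
    (hVβ : ∀ x, r₀ ≤ ‖x‖ → ‖x‖ ^ (β + 1) * ‖gradient V x‖ ≤ M₀) (hH : 0 < H) :
    ∃ (W : E → ℝ) (F : E → E) (K : ℝ), Continuous F ∧ (∀ x, HasGradientAt W (-F x) x) ∧
      (∀ x, ‖F x‖ ≤ K * (1 + ‖x‖) ^ (-(β + 1))) ∧
      (∀ x, W x < 2 * H → x ≠ 0 ∧ W x = V x ∧ F x = -gradient V x) ∧
      ∀ x, x ≠ 0 → V x ≤ 2 * H → W x = V x := by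
  have := FiniteDimensional.proper_real E
  have ho : IsOpen ({0}ᶜ : Set E) := isOpen_compl_singleton
  have hVd : ∀ x, x ≠ 0 → DifferentiableAt ℝ V x := fun x hx =>
    (hV.contDiffAt (ho.mem_nhds hx)).differentiableAt one_ne_zero
  have hgrad : ∀ x, x ≠ 0 → ContinuousAt (gradient V) x := fun x hx =>
    (InnerProductSpace.toDual ℝ E).symm.continuous.continuousAt.comp
      ((hV.continuousOn_fderiv_of_isOpen ho le_rfl).continuousAt (ho.mem_nhds hx))
  obtain ⟨ρ, hρ, hVρ⟩ := exists_forall_le_of_norm_le hα hVd hVα hVpos (3 * H)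
  obtain ⟨ψ, χ, hχ, hχ0, hχ1, hψ, hψ2, hχ2, hψ3, hχ3, hψH⟩ := exists_truncation hH
  set W : E → ℝ := fun x => if x = 0 then ψ (3 * H) else ψ (V x) with hWdef
  set F : E → E := fun x => if x = 0 then 0 else -χ (V x) • gradient V x with hFdef
  have hW0 : ∀ x, x ≠ 0 → W x = ψ (V x) := fun x hx => if_neg hx
  have hF0 : ∀ x, x ≠ 0 → F x = -χ (V x) • gradient V x := fun x hx => if_neg hx
  have hWρ : ∀ x ∈ Metric.ball (0 : E) ρ, W x = ψ (3 * H) := by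
    intro x hx
    by_cases h : x = 0
    · exact if_pos h
    · rw [hW0 x h, hψ3 _ (hVρ x h (by simpa using hx))]
  have hFρ : ∀ x ∈ Metric.ball (0 : E) ρ, F x = 0 := by
    intro x hx
    by_cases h : x = 0
    · exact if_pos h
    · rw [hF0 x h, hχ3 _ (hVρ x h (by simpa using hx)), neg_zero, zero_smul]
  have hball : Metric.ball (0 : E) ρ ∈ nhds 0 := Metric.ball_mem_nhds 0 hρ
  have hFc : Continuous F := by
    rw [continuous_iff_continuousAt]
    intro x
    by_cases h : x = 0
    · subst h
      exact (continuousAt_const (y := (0 : E))).congr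
        (Filter.eventually_of_mem hball fun x hx => (hFρ x hx).symm)
    · exact (((hχ.continuousAt.comp (hVd x h).continuousAt).neg).smul (hgrad x h)).congr
        (Filter.eventually_of_mem (ho.mem_nhds h) fun x hx => (hF0 x hx).symm)
  obtain ⟨C, hC⟩ := (isCompact_closedBall (0 : E) r₀).exists_bound_of_continuousOn
    (f := fun x => (1 + ‖x‖) ^ (β + 1) • F x) (by
      refine Continuous.continuousOn ?_
      exact ((continuous_const.add continuous_norm).rpow_const fun x => Or.inr hβ).smul hFc)
  refine ⟨W, F, max C (2 ^ (β + 1) * M₀), hFc, fun x => ?_, fun x => ?_, fun x hx => ?_,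
    fun x hx hxH => by rw [hW0 x hx, hψ2 _ hxH]⟩
  · by_cases h : x = 0
    · subst h
      rw [hFρ 0 (Metric.mem_ball_self hρ), neg_zero]
      exact (hasGradientAt_const (0 : E) (ψ (3 * H))).congr_of_eventuallyEq
        (Filter.eventually_of_mem hball hWρ)
    · rw [hF0 x h, neg_smul, neg_neg]
      have h1 := (hψ (V x)).comp_hasFDerivAt x (hVd x h).hasGradientAt.hasFDerivAt
      rw [← map_smul] at h1
      exact HasGradientAt.congr_of_eventuallyEq (hasGradientAt_iff_hasFDerivAt.2 h1)
        (Filter.eventually_of_mem (ho.mem_nhds h) hW0)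
  · have hpos : 0 < 1 + ‖x‖ := by positivity
    rw [Real.rpow_neg hpos.le, ← div_eq_mul_inv, le_div_iff₀ (by positivity), mul_comm]
    rcases le_total ‖x‖ r₀ with h | h
    · have := hC x (by simpa using h)
      rw [norm_smul, Real.norm_of_nonneg (by positivity)] at this
      exact this.trans (le_max_left _ _)
    · refine le_trans ?_ (le_max_right _ _)
      have hx : x ≠ 0 := norm_pos_iff.1 (by linarith)
      have h1 : ‖F x‖ ≤ ‖gradient V x‖ := by
        rw [hF0 x hx, norm_smul, norm_neg, Real.norm_of_nonneg (hχ0 _)]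
        exact mul_le_of_le_one_left (norm_nonneg _) (hχ1 _)
      calc (1 + ‖x‖) ^ (β + 1) * ‖F x‖ ≤ (2 * ‖x‖) ^ (β + 1) * ‖gradient V x‖ := by
            gcongr; linarith
        _ = 2 ^ (β + 1) * (‖x‖ ^ (β + 1) * ‖gradient V x‖) := by
            rw [Real.mul_rpow zero_le_two (norm_nonneg _), mul_assoc]
        _ ≤ 2 ^ (β + 1) * M₀ := by gcongr; exact hVβ x h
  · have h : x ≠ 0 := by
      rintro rfl
      have h1 := hψH (3 * H) (by linarith)
      rw [hWρ 0 (Metric.mem_ball_self hρ)] at hx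
      linarith
    have hVx : V x ≤ 2 * H := by
      by_contra! h2
      have := hψH _ h2.le
      rw [hW0 x h] at hx
      linarith
    refine ⟨h, by rw [hW0 x h, hψ2 _ hVx], ?_⟩
    rw [hF0 x h, hχ2 _ hVx, neg_smul, one_smul]

end

section

variable {E : Type*} [NormedAddCommGroup E] [InnerProductSpace ℝ E] [FiniteDimensional ℝ E]
  {F : E → E} {W p : E → ℝ} {e : E} {H K R α β : ℝ}

/-- Approximate brake orbits whose position at time `T` lies on a prescribed ray. -/
theorem exists_approx_orbit_to_ray (hF : Continuous F) (hW : ∀ x, HasGradientAt W (-F x) x)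
    (hα : α ∈ Set.Ioo (0 : ℝ) 2) (hWF : ∀ x, W x < 2 * H → ⟪x, F x⟫_ℝ = α * W x) (hH : 0 < H)
    (hFK : ∀ x, ‖F x‖ ≤ K) (hpc : ContinuousOn p (Metric.sphere 0 1))
    (hp0 : ∀ x, ‖x‖ = 1 → 0 < p x) (hpR : ∀ x, ‖x‖ = 1 → p x ≤ R)
    (hpH : ∀ x, ‖x‖ = 1 → W (p x • x) = H) (he : ‖e‖ = 1) {T ε : ℝ} (hT : 0 < T) (hε : 0 < ε)
    (hεs : (3 * (K * T ^ 2) + R) * ε ≤ α * H / 2) :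
    ∃ (u v a : ℝ → E) (c : ℝ), (∀ t, HasDerivAt u (v t) t) ∧ (∀ t, HasDerivAt v (a t) t) ∧
      v 0 = 0 ∧ (∀ t, u (-t) = u t) ∧ W (u 0) = H ∧ ‖u 0‖ ≤ R ∧ (∀ t, ‖a t‖ ≤ K) ∧
      (∀ t, |t| ≤ T → ‖a t - F (u t)‖ ≤ ε) ∧ 0 ≤ c ∧ u T = c • e := by
  have := FiniteDimensional.complete ℝ E
  have hnorm : ∀ x, ‖x‖ = 1 → ‖p x • x‖ = p x := fun x hx => by
    rw [norm_smul, hx, mul_one, Real.norm_of_nonneg (hp0 x hx).le]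
  obtain ⟨u, v, a, huc, hu0, hv0, hu, hv, hev, ha, happ⟩ :=
    exists_approx_solution_family hF hFK R hT hε
  have hne : ∀ x, ‖x‖ = 1 → ∀ t ∈ Set.Icc (0 : ℝ) 1, u (p x • x) (T * t) ≠ 0 := by
    intro x hx t ht
    have h1 := energy_virial_estimates hW hα hWF hH (hu (p x • x)) (hv _) (hv0 _)
      (by rw [hu0, hpH x hx]) (ha _) hε.le
      (happ _ (by rw [hnorm x hx]; exact hpR x hx))
      (by
        refine le_trans ?_ hεs
        rw [hu0, hnorm x hx]
        gcongr
        exact hpR x hx)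
      (t := T * t) ⟨mul_nonneg hT.le ht.1, mul_le_of_le_one_right hT.le ht.2⟩
    have h2 := h1.2.2
    rw [hu0, hnorm x hx] at h2
    intro h0
    rw [h0, norm_zero] at h2
    have h3 : 0 ≤ α * H / 2 * (T * t) ^ 2 := by have := hα.1; positivity
    nlinarith [hp0 x hx]
  obtain ⟨x, hx, hxe⟩ := exists_eq_of_homotopy_id
    (G := fun x t => ‖u (p x • x) (T * t)‖⁻¹ • u (p x • x) (T * t)) (by
      have hpc' : ContinuousOn (fun z : E × ℝ => p z.1) (Metric.sphere 0 1 ×ˢ Set.Icc 0 1) :=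
        hpc.comp continuousOn_fst fun z hz => hz.1
      have h1 : ContinuousOn (fun z : E × ℝ => u (p z.1 • z.1) (T * z.2))
          (Metric.sphere 0 1 ×ˢ Set.Icc 0 1) :=
        huc.comp_continuousOn ((hpc'.smul continuousOn_fst).prodMk
          (continuousOn_const.mul continuousOn_snd))
      exact (h1.norm.inv₀ fun z hz =>
        (norm_pos_iff.2 (hne z.1 (by simpa using hz.1) z.2 hz.2)).ne').smul h1)
    (fun x hx t ht => norm_smul_inv_norm (𝕜 := ℝ) (hne x hx t ht))
    (fun x hx => by
      simp only [mul_zero]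
      rw [hu0, hnorm x hx, inv_smul_smul₀ (hp0 x hx).ne']) e he
  refine ⟨u (p x • x), v (p x • x), a (p x • x), ‖u (p x • x) T‖, hu _, hv _, hv0 _, hev _,
    by rw [hu0, hpH x hx], by rw [hu0, hnorm x hx]; exact hpR x hx, ha _,
    happ _ (by rw [hnorm x hx]; exact hpR x hx), norm_nonneg _, ?_⟩
  have h1 := hne x hx 1 (by simp)
  rw [mul_one] at h1 hxe
  rw [← hxe, smul_inv_smul₀ (norm_ne_zero_iff.2 h1)]

/-- A brake orbit in a regular repulsive potential with short-range force that stays within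
bounded distance of a prescribed ray. -/
theorem exists_brake_orbit_near_ray (hF : Continuous F) (hW : ∀ x, HasGradientAt W (-F x) x)
    (hα : α ∈ Set.Ioo (0 : ℝ) 2) (hWF : ∀ x, W x < 2 * H → ⟪x, F x⟫_ℝ = α * W x) (hH : 0 < H)
    (hβ : 1 < β) (hFK : ∀ x, ‖F x‖ ≤ K * (1 + ‖x‖) ^ (-(β + 1)))
    (hpc : ContinuousOn p (Metric.sphere 0 1))
    (hp0 : ∀ x, ‖x‖ = 1 → 0 < p x) (hpR : ∀ x, ‖x‖ = 1 → p x ≤ R)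
    (hpH : ∀ x, ‖x‖ = 1 → W (p x • x) = H) (he : ‖e‖ = 1) :
    ∃ (u v : ℝ → E) (C : ℝ), (∀ t, HasDerivAt u (v t) t) ∧ (∀ t, HasDerivAt v (F (u t)) t) ∧
      v 0 = 0 ∧ (∀ t, u (-t) = u t) ∧ W (u 0) = H ∧ ∀ t, ‖u t - ‖u t‖ • e‖ ≤ C := by
  have := FiniteDimensional.complete ℝ E
  have hK : 0 ≤ K := by simpa using (norm_nonneg _).trans (hFK 0)
  have hR : 0 ≤ R := (hp0 e he).le.trans (hpR e he)
  have hA : 0 < α * H / 2 := by have := hα.1; positivity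
  have hFK' : ∀ x, ‖F x‖ ≤ K := fun x => (hFK x).trans (mul_le_of_le_one_right hK
    (Real.rpow_le_one_of_one_le_of_nonpos (by linarith [norm_nonneg x]) (by linarith)))
  have hε : ∀ n : ℕ, ∃ ε > 0, (3 * (K * (n + 1 : ℝ) ^ 2) + R) * ε ≤ α * H / 2 ∧
      ε * (n + 1 : ℝ) ^ 2 ≤ 1 ∧ ε ≤ 1 / (n + 1 : ℝ) := by
    intro n
    have hn : (0 : ℝ) < n + 1 := by positivity
    have hD : 0 < 3 * (K * (n + 1 : ℝ) ^ 2) + R + 1 := by positivity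
    refine ⟨min (α * H / 2 / (3 * (K * (n + 1 : ℝ) ^ 2) + R + 1))
      (min (1 / (n + 1 : ℝ) ^ 2) (1 / (n + 1 : ℝ))), by positivity, ?_, ?_,
      (min_le_right _ _).trans (min_le_right _ _)⟩
    · calc _ ≤ (3 * (K * (n + 1 : ℝ) ^ 2) + R + 1) *
            (α * H / 2 / (3 * (K * (n + 1 : ℝ) ^ 2) + R + 1)) := by
            refine mul_le_mul (by linarith) (min_le_left _ _) (by positivity) hD.le
        _ = _ := mul_div_cancel₀ _ hD.ne'
    · rw [← le_div_iff₀ (by positivity)]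
      exact (min_le_right _ _).trans (min_le_left _ _)
  choose ε hε0 hεs hεT hεn using hε
  choose u v a c hu hv hv0 hev huH hu0 ha happ hc huT using fun n : ℕ =>
    exists_approx_orbit_to_ray hF hW hα hWF hH hFK' hpc hp0 hpR hpH he
      (by positivity : (0 : ℝ) < n + 1) (hε0 n) (hεs n)
  obtain ⟨l, U, U', hl, hlat, hlim, hU'0, hU, hU'⟩ :=
    exists_solution_of_approx_solutions hF hu hv hv0 hu0 ha (by
      intro T η hη
      filter_upwards [Filter.eventually_ge_atTop ⌈T⌉₊,
        (tendsto_one_div_add_atTop_nhds_zero_nat (𝕜 := ℝ)).eventually_le_const hη]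
        with n hn1 hn2 t ht
      have : T ≤ n := (Nat.le_ceil T).trans (by exact_mod_cast hn1)
      exact (happ n t (by linarith)).trans ((hεn n).trans hn2))
  set κ := min 1 (Real.sqrt (α * H / 2)) with hκdef
  have hκ : 0 < κ := lt_min one_pos (Real.sqrt_pos.2 hA)
  have hclose : ∀ n : ℕ, ∀ t ∈ Set.Icc (0 : ℝ) (n + 1), ‖u n t - ‖u n t‖ • e‖ ≤
      2 * (R + K * κ ^ (-(β + 1)) / (β - 1) + 1) := by
    intro n t ht
    refine norm_sub_norm_smul_le_of_deriv_decay (hu n) (hv n) he hβ (by positivity) (hu0 n)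
      (hε0 n).le (hεT n) (fun s hs => ?_) (hc n) (huT n) ht
    have h1 := (energy_virial_estimates hW hα hWF hH (hu n) (hv n) (hv0 n) (huH n) (ha n)
      (hε0 n).le (happ n) (le_trans (by have := (hε0 n).le; gcongr; exact hu0 n) (hεs n)) hs).2.2
    have hs1 : 0 < 1 + s := by linarith [hs.1]
    have h2 : Real.sqrt (α * H / 2) * s ≤ ‖u n s‖ := by
      refine le_of_sq_le_sq ?_ (norm_nonneg _)
      rw [mul_pow, Real.sq_sqrt hA.le]
      nlinarith [sq_nonneg ‖u n 0‖]
    have h3 : κ * (1 + s) ≤ 1 + ‖u n s‖ := by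
      have := mul_le_mul_of_nonneg_right (min_le_right 1 (Real.sqrt (α * H / 2))) hs.1
      have := min_le_left 1 (Real.sqrt (α * H / 2))
      rw [mul_add]
      linarith
    have h4 : ‖a n s‖ ≤ ‖F (u n s)‖ + ε n := by
      have := happ n s (by rw [abs_of_nonneg hs.1]; exact hs.2)
      linarith [norm_sub_norm_le (a n s) (F (u n s))]
    refine h4.trans (add_le_add ((hFK _).trans ?_) le_rfl)
    rw [mul_assoc, ← Real.mul_rpow hκ.le hs1.le]
    exact mul_le_mul_of_nonneg_left
      (Real.rpow_le_rpow_of_nonpos (by positivity) h3 (by linarith)) hK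
  have hUev : ∀ t, U (-t) = U t := fun t =>
    tendsto_nhds_unique (hlim (-t)) (by simpa only [hev] using hlim t)
  refine ⟨U, U', 2 * (R + K * κ ^ (-(β + 1)) / (β - 1) + 1), hU, hU', hU'0, hUev, ?_, ?_⟩
  · have hWc : ContinuousAt W (U 0) := (hW _).continuousAt
    refine tendsto_nhds_unique (hWc.tendsto.comp (hlim 0)) ?_
    simp only [Function.comp_def, huH]
    exact tendsto_const_nhds
  · have key : ∀ t, 0 ≤ t → ‖U t - ‖U t‖ • e‖ ≤
        2 * (R + K * κ ^ (-(β + 1)) / (β - 1) + 1) := by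
      intro t ht
      refine le_of_tendsto ((hlim t).sub ((hlim t).norm.smul_const e)).norm (hlat ?_)
      filter_upwards [Filter.eventually_ge_atTop ⌈t⌉₊] with n hn
      have : t ≤ n := (Nat.le_ceil t).trans (by exact_mod_cast hn)
      exact hclose n t ⟨ht, by linarith⟩
    intro t
    rcases le_total 0 t with h | h
    · exact key t h
    · rw [← hUev]; exact key (-t) (by linarith)

end

open scoped Topology in
theorem tendsto_inv_norm_smul_of_norm_sub_le {E : Type*} [NormedAddCommGroup E]
    [NormedSpace ℝ E] {u : ℝ → E} {e : E} {C : ℝ} {l : Filter ℝ} (hne : ∀ t, u t ≠ 0)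
    (hC : ∀ t, ‖u t - ‖u t‖ • e‖ ≤ C) (hu : Filter.Tendsto (fun t => ‖u t‖) l Filter.atTop) :
    Filter.Tendsto (fun t => ‖u t‖⁻¹ • u t) l (𝓝 e) := by
  rw [tendsto_iff_norm_sub_tendsto_zero]
  have h0 : Filter.Tendsto (fun t => ‖u t‖⁻¹ * C) l (𝓝 0) := by
    simpa using hu.inv_tendsto_atTop.mul_const C
  refine squeeze_zero (fun _ => norm_nonneg _) (fun t => ?_) h0
  have h1 : ‖u t‖⁻¹ • u t - e = ‖u t‖⁻¹ • (u t - ‖u t‖ • e) := by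
    rw [smul_sub, inv_smul_smul₀ (norm_ne_zero_iff.2 (hne t))]
  rw [h1, norm_smul, norm_inv, norm_norm]
  exact mul_le_mul_of_nonneg_left (hC t) (by positivity)

/-- Theorem 1.5 (hyperbolic orbit with prescribed asymptotic direction): under
(B₁), (V₁) and (V₂), for every `H > 0` and unit vector `e` there is a global
`C²` hyperbolic solution with asymptotic direction `e` at `t → ±∞`. -/
theorem stmt_13 {N : ℕ} (hN : 2 ≤ N) (V : EuclideanSpace ℝ (Fin N) → ℝ)
    (hV : ContDiffOn ℝ 1 V {0}ᶜ)
    (hB1 : ∀ x : EuclideanSpace ℝ (Fin N), x ≠ 0 → V (-x) = V x)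
    (α : ℝ) (hα : α ∈ Set.Ioo (0 : ℝ) 2)
    (hV1 : ∀ x : EuclideanSpace ℝ (Fin N), x ≠ 0 →
      ⟪x, gradient V x⟫_ℝ = -α * V x ∧ -α * V x < 0)
    (β M₀ r₀ : ℝ) (hβ : 1 < β) (hM₀ : 0 < M₀) (hr₀ : 1 ≤ r₀)
    (hV2 : ∀ x : EuclideanSpace ℝ (Fin N), r₀ ≤ ‖x‖ →
      ‖x‖ ^ (β + 1) * ‖gradient V x‖ ≤ M₀)
    (H : ℝ) (hH : 0 < H)
    (e : EuclideanSpace ℝ (Fin N)) (he : ‖e‖ = 1) :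
    ∃ u : ℝ → EuclideanSpace ℝ (Fin N),
      ContDiff ℝ 2 u ∧
      (∀ t, u t ≠ 0) ∧
      (∀ t, deriv (deriv u) t + gradient V (u t) = 0) ∧
      (∀ t, (1/2) * ‖deriv u t‖ ^ 2 + V (u t) = H) ∧
      Filter.Tendsto (fun t => ‖u t‖) Filter.atTop Filter.atTop ∧
      Filter.Tendsto (fun t => ‖u t‖) Filter.atBot Filter.atTop ∧
      Filter.Tendsto (fun t => ‖u t‖⁻¹ • u t) Filter.atTop (nhds e) ∧
      Filter.Tendsto (fun t => ‖u t‖⁻¹ • u t) Filter.atBot (nhds e) := by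
  have hαpos := hα.1
  have hVα : ∀ x, x ≠ 0 → ⟪x, gradient V x⟫_ℝ = -α * V x := fun x hx => (hV1 x hx).1
  have hVpos : ∀ x, x ≠ 0 → 0 < V x := fun x hx => by
    have := (hV1 x hx).2
    nlinarith
  have hVd : ∀ x, x ≠ 0 → DifferentiableAt ℝ V x := fun x hx =>
    (hV.contDiffAt (isOpen_compl_singleton.mem_nhds hx)).differentiableAt one_ne_zero
  have hne1 : ∀ x : EuclideanSpace ℝ (Fin N), ‖x‖ = 1 → x ≠ 0 := fun x hx =>
    norm_pos_iff.1 (hx ▸ one_pos)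
  obtain ⟨W, F, K, hF, hW, hFK, hWlt, hWV⟩ :=
    exists_regular_potential hV hαpos hVα hVpos (by linarith) hr₀ hV2 hH
  have hWF : ∀ x, W x < 2 * H → ⟪x, F x⟫_ℝ = α * W x := fun x hx => by
    obtain ⟨h1, h2, h3⟩ := hWlt x hx
    rw [h3, h2, inner_neg_right, hVα x h1]
    ring
  have hpc : ContinuousOn (fun x => (V x / H) ^ α⁻¹) (Metric.sphere 0 1) := fun x hx =>
    (((hVd x (hne1 x (by simpa using hx))).continuousAt.div_const H).rpow_const
      (Or.inr (by positivity))).continuousWithinAt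
  have hp0 : ∀ x, ‖x‖ = 1 → 0 < (V x / H) ^ α⁻¹ := fun x hx =>
    Real.rpow_pos_of_pos (div_pos (hVpos x (hne1 x hx)) hH) _
  have hpH : ∀ x, ‖x‖ = 1 → W ((V x / H) ^ α⁻¹ • x) = H := fun x hx => by
    have hx0 := hne1 x hx
    have h1 : V ((V x / H) ^ α⁻¹ • x) = H := by
      rw [map_smul_of_inner_gradient_eq hVd hVα hx0 (hp0 x hx),
        ← Real.rpow_mul (div_pos (hVpos x hx0) hH).le, mul_neg, inv_mul_cancel₀ hαpos.ne',
        Real.rpow_neg_one]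
      have := (hVpos x hx0).ne'
      field_simp
    rw [hWV _ (smul_ne_zero (hp0 x hx).ne' hx0) (by linarith), h1]
  obtain ⟨R, hR⟩ :=
    (isCompact_sphere (0 : EuclideanSpace ℝ (Fin N)) 1).exists_bound_of_continuousOn hpc
  obtain ⟨u, v, C, hu, hv, hv0, hev, hu0, hC⟩ := exists_brake_orbit_near_ray (R := R) hF hW hα
    hWF hH hβ hFK hpc hp0
    (fun x hx => (le_abs_self _).trans (hR x (by simpa using hx))) hpH he
  have hest : ∀ t, 0 ≤ t → 1 / 2 * ‖v t‖ ^ 2 + W (u t) = H ∧ W (u t) < 2 * H ∧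
      ‖u 0‖ ^ 2 + α * H / 2 * t ^ 2 ≤ ‖u t‖ ^ 2 := fun t ht => by
    have hFb : ∀ x, ‖F x‖ ≤ K := fun x => by
      have hK : 0 ≤ K := by simpa using (norm_nonneg _).trans (hFK 0)
      exact (hFK x).trans (mul_le_of_le_one_right hK
        (Real.rpow_le_one_of_one_le_of_nonpos (by linarith [norm_nonneg x]) (by linarith)))
    obtain ⟨h1, h2, h3⟩ := energy_virial_estimates hW hα hWF hH hu hv hv0 hu0
      (fun s => hFb (u s)) le_rfl (T := t) (fun s _ => by simp) (by simp; positivity)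
      (t := t) ⟨ht, le_rfl⟩
    rw [mul_zero] at h1
    exact ⟨by linarith [abs_nonpos_iff.1 h1], h2, h3⟩
  have hvodd : ∀ t, v (-t) = -v t := fun t => by
    have h1 := (hu (-t)).scomp t (hasDerivAt_neg t)
    rw [show u ∘ Neg.neg = u from funext hev] at h1
    rw [h1.unique (hu t) |>.symm]
    simp
  have hall : ∀ t, 1 / 2 * ‖v t‖ ^ 2 + W (u t) = H ∧ W (u t) < 2 * H ∧
      ‖u 0‖ ^ 2 + α * H / 2 * t ^ 2 ≤ ‖u t‖ ^ 2 := fun t => by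
    rcases le_total 0 t with h | h
    · exact hest t h
    · simpa only [hev, hvodd, norm_neg, neg_sq] using hest (-t) (neg_nonneg.2 h)
  have hne : ∀ t, u t ≠ 0 := fun t => (hWlt _ (hall t).2.1).1
  have hdu : deriv u = v := funext fun t => (hu t).deriv
  have hdv : deriv v = fun t => F (u t) := funext fun t => (hv t).deriv
  have huc : Continuous u := continuous_iff_continuousAt.2 fun t => (hu t).continuousAt
  have htop : Filter.Tendsto (fun t => ‖u t‖) Filter.atTop Filter.atTop := by
    have hA : 0 < Real.sqrt (α * H / 2) := Real.sqrt_pos.2 (by positivity)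
    refine Filter.tendsto_atTop_mono (fun t => le_of_sq_le_sq ?_ (norm_nonneg _))
      (Filter.tendsto_id.const_mul_atTop hA)
    rw [mul_pow, Real.sq_sqrt (by positivity)]
    exact (le_add_of_nonneg_left (sq_nonneg _)).trans (hall t).2.2
  have hbot : Filter.Tendsto (fun t => ‖u t‖) Filter.atBot Filter.atTop :=
    (htop.comp Filter.tendsto_neg_atBot_atTop).congr fun t => by simp only [Function.comp, hev]
  refine ⟨u, ?_, hne, fun t => ?_, fun t => ?_, htop, hbot,
    tendsto_inv_norm_smul_of_norm_sub_le hne hC htop,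
    tendsto_inv_norm_smul_of_norm_sub_le hne hC hbot⟩
  · rw [show (2 : WithTop ℕ∞) = 1 + 1 by norm_num, contDiff_succ_iff_deriv, hdu,
      contDiff_one_iff_deriv, hdv]
    exact ⟨fun t => (hu t).differentiableAt, by simp, fun t => (hv t).differentiableAt,
      hF.comp huc⟩
  · rw [hdu, (hv t).deriv, (hWlt _ (hall t).2.1).2.2, neg_add_cancel]
  · rw [hdu, ← (hWlt _ (hall t).2.1).2.1, (hall t).1]
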